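/- arXiv:1605.05063 — 3 statements merged into one kernel-verified Lean document; each statement's English description precedes it below -/
import Mathlib

section
/- Let γ > 0 and T > 2π/γ. Let ω : ℤ → ℝ be a strictly increasing sequence satisfying the gap condition ω_{k+1} − ω_k ≥ γ for all k ∈ ℤ. Then for every finitely supported sequence a : ℤ → ℂ, C₁ · Σ_{k∈ℤ} |a_k|² ≤ ∫_0^T |Σ_{k∈ℤ} a_k e^{i ω_k t}|² dt ≤ C₂ · Σ_{k∈ℤ} |a_k|², where C₁ = (2T/π)(1 − 4π²/(T²γ²)) and C₂ = (8T/π)(1 + 4π²/(T²γ²)). -/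
open MeasureTheory

lemma ing_sum (N : ℕ) : ∑ n ∈ (Finset.Icc (-(N:ℤ)) N).erase 0, (1:ℝ) / (4 * (n:ℝ)^2 - 1)
    = 1 - 1 / (2 * (N:ℝ) + 1) := by
  induction N with
  | zero => simp
  | succ N ih =>
    have h : (Finset.Icc (-((N+1:ℕ):ℤ)) ((N+1:ℕ):ℤ)).erase 0 =
        insert (-((N:ℤ)+1)) (insert ((N:ℤ)+1) ((Finset.Icc (-(N:ℤ)) N).erase 0)) := by
      ext x
      simp only [Finset.mem_erase, Finset.mem_Icc, Finset.mem_insert]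
      push_cast
      omega
    rw [h, Finset.sum_insert, Finset.sum_insert, ih]
    · push_cast
      have h1 : (2 * (N:ℝ) + 1) ≠ 0 := by positivity
      have h2 : (2 * ((N:ℝ) + 1) + 1) ≠ 0 := by positivity
      have h3 : 4 * ((N:ℝ)+1)^2 - 1 = (2 * (N:ℝ) + 1) * (2 * ((N:ℝ) + 1) + 1) := by ring
      rw [neg_sq, h3]
      field_simp
      ring
    · simp
    · simp only [Finset.mem_erase, Finset.mem_Icc, Finset.mem_insert]
      omega

lemma ing_pos (n : ℤ) (hn : n ≠ 0) : 0 < 4 * (n:ℝ)^2 - 1 := by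
  have : (1:ℤ) ≤ n^2 := by have := sq_pos_of_ne_zero hn; omega
  have : (1:ℝ) ≤ (n:ℝ)^2 := by exact_mod_cast this
  linarith

lemma ing_sum_le (s : Finset ℤ) (j : ℤ) :
    ∑ k ∈ s.erase j, (1:ℝ) / (4 * ((k - j : ℤ):ℝ)^2 - 1) ≤ 1 := by
  obtain ⟨N, hN⟩ : ∃ N : ℕ, ∀ k ∈ s, |k - j| ≤ (N:ℤ) := by
    refine ⟨∑ k ∈ s, (k-j).natAbs, fun k hk => ?_⟩
    have := Finset.single_le_sum (f := fun k => (k-j).natAbs) (fun _ _ => Nat.zero_le _) hk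
    rw [Int.abs_eq_natAbs]
    exact_mod_cast this
  have hinj : Set.InjOn (fun k : ℤ => k - j) (s.erase j) := fun a _ b _ h => by
    simp only at h; omega
  rw [← Finset.sum_image (f := fun n : ℤ => (1:ℝ) / (4 * (n:ℝ)^2 - 1)) hinj]
  calc _ ≤ ∑ n ∈ (Finset.Icc (-(N:ℤ)) N).erase 0, (1:ℝ) / (4 * (n:ℝ)^2 - 1) := by
        apply Finset.sum_le_sum_of_subset_of_nonneg
        · intro x hx
          simp only [Finset.mem_image, Finset.mem_erase] at hx
          obtain ⟨k, ⟨hk, hks⟩, rfl⟩ := hx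
          have := abs_le.1 (hN k hks)
          simp only [Finset.mem_erase, Finset.mem_Icc]
          omega
        · intro i hi _
          have := ing_pos i (Finset.mem_erase.1 hi).1
          positivity
    _ ≤ 1 := by
        rw [ing_sum]
        have : (0:ℝ) ≤ 1 / (2 * N + 1) := by positivity
        linarith

lemma ing_gap (γ : ℝ) (ω : ℤ → ℝ) (hγ : 0 < γ) (hgap : ∀ k : ℤ, ω (k + 1) - ω k ≥ γ) (j k : ℤ) :
    γ^2 * ((k - j : ℤ):ℝ)^2 ≤ (ω k - ω j)^2 := by
  have hm : Monotone (fun k : ℤ => ω k - γ * k) := by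
    apply monotone_int_of_le_succ
    intro n
    have := hgap n
    push_cast
    linarith
  rw [← mul_pow]
  apply sq_le_sq.2
  rcases le_total j k with h | h
  · have h1 := hm h
    have h2 : (j:ℝ) ≤ k := by exact_mod_cast h
    simp only at h1
    push_cast
    rw [abs_of_nonneg (mul_nonneg hγ.le (by linarith))]
    exact le_trans (by linarith) (le_abs_self _)
  · have h1 := hm h
    have h2 : (k:ℝ) ≤ j := by exact_mod_cast h
    simp only at h1
    push_cast
    rw [abs_of_nonpos (mul_nonpos_of_nonneg_of_nonpos hγ.le (by linarith))]
    exact le_trans (by linarith) (neg_le_abs _)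

lemma ing_K (T p x : ℝ) (hT : 0 < T) (hp : p = Real.pi / T) (hx : p^2 - x^2 ≠ 0) :
    ∫ t in (-(T/2))..(T/2), (Real.cos (p * t) : ℂ) * Complex.exp (Complex.I * x * t) =
    (Complex.exp (Complex.I * x * (T/2:ℝ)) + Complex.exp (Complex.I * x * (-(T/2):ℝ))) *
      (p / ((p^2 - x^2 : ℝ) : ℂ)) := by
  have hx' : ((p^2 - x^2 : ℝ) : ℂ) ≠ 0 := by exact_mod_cast hx
  have hd : ∀ t : ℝ, HasDerivAt (fun t : ℝ => Complex.exp (Complex.I * x * t) *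
      (Complex.I * x * (Real.cos (p * t) : ℝ) + p * (Real.sin (p*t) : ℝ)) / ((p^2 - x^2 : ℝ) : ℂ))
      ((Real.cos (p * t) : ℂ) * Complex.exp (Complex.I * x * t)) t := by
    intro t
    have h0 : HasDerivAt (fun t : ℝ => p * t) p t := by
      simpa using (hasDerivAt_id t).const_mul p
    have h1 : HasDerivAt (fun t : ℝ => ((Real.cos (p * t) : ℝ) : ℂ)) ((-Real.sin (p*t) * p : ℝ) : ℂ) t :=
      h0.cos.ofReal_comp
    have h2 : HasDerivAt (fun t : ℝ => ((Real.sin (p * t) : ℝ) : ℂ)) ((Real.cos (p*t) * p : ℝ) : ℂ) t :=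
      h0.sin.ofReal_comp
    have h3 : HasDerivAt (fun t : ℝ => Complex.exp (Complex.I * x * t))
        (Complex.exp (Complex.I * x * t) * (Complex.I * x * 1)) t := by
      have := ((hasDerivAt_id t).ofReal_comp).const_mul (Complex.I * x)
      simpa using this.cexp
    have h4 := (h3.mul ((h1.const_mul (Complex.I * x)).add (h2.const_mul (p:ℂ)))).div_const
      ((p^2 - x^2 : ℝ) : ℂ)
    refine h4.congr_deriv ?_
    rw [div_eq_iff hx']
    simp only [Pi.add_apply]
    push_cast
    ring_nf
    rw [Complex.I_sq]
    ring
  rw [intervalIntegral.integral_eq_sub_of_hasDerivAt (fun t _ => hd t)]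
  · have e1 : p * (T/2) = Real.pi/2 := by rw [hp]; field_simp
    have e2 : p * (-(T/2)) = -(Real.pi/2) := by rw [← e1]; ring
    rw [e1, e2, Real.cos_neg, Real.sin_neg, Real.cos_pi_div_two, Real.sin_pi_div_two]
    push_cast
    ring
  · apply Continuous.intervalIntegrable
    fun_prop

lemma ing_exp_norm (x t : ℝ) : ‖Complex.exp (Complex.I * x * t)‖ = 1 := by
  have : Complex.I * x * t = ((x * t : ℝ) : ℂ) * Complex.I := by push_cast; ring
  rw [this, Complex.norm_exp_ofReal_mul_I]

lemma ing_expand (ω : ℤ → ℝ) (s : Finset ℤ) (b : ℤ → ℂ) (t : ℝ) :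
    ((‖∑ k ∈ s, b k * Complex.exp (Complex.I * (ω k : ℂ) * (t : ℂ))‖ ^ 2 : ℝ) : ℂ) =
    ∑ k ∈ s, ∑ j ∈ s, b k * (starRingEnd ℂ) (b j) *
      Complex.exp (Complex.I * ((ω k - ω j : ℝ) : ℂ) * (t : ℂ)) := by
  push_cast
  rw [← Complex.mul_conj', map_sum, Finset.sum_mul_sum]
  refine Finset.sum_congr rfl fun k _ => Finset.sum_congr rfl fun j _ => ?_
  rw [map_mul, ← Complex.exp_conj]
  simp only [map_mul, Complex.conj_I, Complex.conj_ofReal]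
  rw [mul_mul_mul_comm, ← Complex.exp_add]
  congr 2
  ring

lemma ing_main (γ T p : ℝ) (hγ : 0 < γ) (hT0 : 0 < T) (hp : p = Real.pi / T) (hpγ : 2 * p < γ)
    (ω : ℤ → ℝ) (hgap : ∀ k : ℤ, ω (k + 1) - ω k ≥ γ) (s : Finset ℤ) (b : ℤ → ℂ) :
    |(∫ t in (-(T/2))..(T/2), Real.cos (p * t) *
      ‖∑ k ∈ s, b k * Complex.exp (Complex.I * (ω k : ℂ) * (t : ℂ))‖ ^ 2)
      - 2 / p * ∑ k ∈ s, ‖b k‖^2| ≤ 8 * p / γ^2 * ∑ k ∈ s, ‖b k‖^2 := by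
  have hp0 : 0 < p := by rw [hp]; positivity
  set K : ℝ → ℂ := fun x => ∫ t in (-(T/2))..(T/2),
    (Real.cos (p * t) : ℂ) * Complex.exp (Complex.I * x * t) with hK
  have hK0 : K 0 = ((2 / p : ℝ) : ℂ) := by
    have := ing_K T p 0 hT0 hp (by simpa using hp0.ne')
    simp only [hK]
    rw [this]
    have : (p:ℂ) ≠ 0 := by exact_mod_cast hp0.ne'
    simp
    field_simp
    norm_num
  have hKb : ∀ k j : ℤ, k ≠ j →
      ‖K (ω k - ω j)‖ ≤ 8 * p / γ^2 * (1 / (4 * ((k - j : ℤ):ℝ)^2 - 1)) := by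
    intro k j hkj
    have hn := ing_pos (k - j) (sub_ne_zero.2 hkj)
    have hg := ing_gap γ ω hγ hgap j k
    set n : ℝ := ((k - j : ℤ):ℝ)
    set x := ω k - ω j
    have h4 : 4 * p^2 ≤ γ^2 := by nlinarith
    have hlow : γ^2 * (4 * n^2 - 1) / 4 ≤ x^2 - p^2 := by nlinarith
    have hl0 : 0 < γ^2 * (4 * n^2 - 1) / 4 := by positivity
    have := ing_K T p x hT0 hp (by linarith)
    simp only [hK]
    rw [this, norm_mul, norm_div, Complex.norm_real, Complex.norm_real, Real.norm_eq_abs,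
      Real.norm_eq_abs, abs_of_pos hp0, abs_of_neg (by linarith : p^2 - x^2 < 0)]
    calc _ ≤ (1 + 1) * (p / (γ^2 * (4 * n^2 - 1) / 4)) := by
          apply mul_le_mul
          · refine (norm_add_le _ _).trans ?_
            rw [ing_exp_norm, ing_exp_norm]
          · exact div_le_div_of_nonneg_left hp0.le hl0 (by linarith)
          · exact div_nonneg hp0.le (by linarith)
          · norm_num
      _ = _ := by field_simp; ring
  have hI : ((∫ t in (-(T/2))..(T/2), Real.cos (p * t) *
      ‖∑ k ∈ s, b k * Complex.exp (Complex.I * (ω k : ℂ) * (t : ℂ))‖ ^ 2 : ℝ) : ℂ) =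
      ∑ k ∈ s, ∑ j ∈ s, b k * (starRingEnd ℂ) (b j) * K (ω k - ω j) := by
    rw [← intervalIntegral.integral_ofReal]
    simp_rw [Complex.ofReal_mul, ing_expand, Finset.mul_sum]
    rw [intervalIntegral.integral_finsetSum]
    · refine Finset.sum_congr rfl fun k _ => ?_
      rw [intervalIntegral.integral_finsetSum]
      · refine Finset.sum_congr rfl fun j _ => ?_
        simp only [hK]
        rw [← intervalIntegral.integral_const_mul]
        congr 1
        ext t
        ring
      · intro j _
        apply Continuous.intervalIntegrable
        fun_prop
    · intro j _
      apply Continuous.intervalIntegrable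
      fun_prop
  have hdiff : (((∫ t in (-(T/2))..(T/2), Real.cos (p * t) *
      ‖∑ k ∈ s, b k * Complex.exp (Complex.I * (ω k : ℂ) * (t : ℂ))‖ ^ 2)
      - 2 / p * ∑ k ∈ s, ‖b k‖^2 : ℝ) : ℂ) =
      ∑ k ∈ s, ∑ j ∈ s.erase k, b k * (starRingEnd ℂ) (b j) * K (ω k - ω j) := by
    rw [Complex.ofReal_sub, hI, Complex.ofReal_mul, Complex.ofReal_sum, Finset.mul_sum,
      ← Finset.sum_sub_distrib]
    refine Finset.sum_congr rfl fun k hk => ?_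
    rw [← Finset.add_sum_erase s _ hk, sub_self, hK0, Complex.mul_conj']
    push_cast
    ring
  rw [← Real.norm_eq_abs, ← Complex.norm_real, hdiff]
  set C := 8 * p / γ^2 with hC
  have hC0 : 0 ≤ C := by positivity
  set w : ℤ → ℤ → ℝ := fun k j => 1 / (4 * ((k - j : ℤ):ℝ)^2 - 1) with hw
  have hwsymm : ∀ k j, w k j = w j k := by
    intro k j; simp only [hw]; push_cast; congr 2; ring
  have hw1 : ∀ k, ∑ j ∈ s.erase k, w k j ≤ 1 := by
    intro k
    simp_rw [hwsymm k]
    exact ing_sum_le s k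
  have hswap : ∑ k ∈ s, ∑ j ∈ s.erase k, w k j * ‖b j‖^2 =
      ∑ k ∈ s, ∑ j ∈ s.erase k, w k j * ‖b k‖^2 := by
    rw [Finset.sum_comm' (s' := fun j => s.erase j) (t' := s)]
    · refine Finset.sum_congr rfl fun k _ => Finset.sum_congr rfl fun j _ => ?_
      rw [hwsymm]
    · intro x y
      simp only [Finset.mem_erase]
      tauto
  have hle : ∑ k ∈ s, ∑ j ∈ s.erase k, w k j * ‖b k‖^2 ≤ ∑ k ∈ s, ‖b k‖^2 := by
    refine Finset.sum_le_sum fun k _ => ?_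
    rw [← Finset.sum_mul]
    exact mul_le_of_le_one_left (by positivity) (hw1 k)
  calc _ ≤ ∑ k ∈ s, ∑ j ∈ s.erase k, ‖b k * (starRingEnd ℂ) (b j) * K (ω k - ω j)‖ :=
        (norm_sum_le _ _).trans (Finset.sum_le_sum fun k _ => norm_sum_le _ _)
    _ ≤ ∑ k ∈ s, ∑ j ∈ s.erase k, C * ((w k j * ‖b k‖^2 + w k j * ‖b j‖^2) / 2) := by
        refine Finset.sum_le_sum fun k _ => Finset.sum_le_sum fun j hj => ?_
        have hjk := (Finset.mem_erase.1 hj).1.symm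
        have h1 := hKb k j hjk
        have h2 : 0 < w k j := one_div_pos.2 (ing_pos (k-j) (sub_ne_zero.2 hjk))
        rw [norm_mul, norm_mul, RCLike.norm_conj]
        calc _ ≤ ((‖b k‖^2 + ‖b j‖^2)/2) * (C * w k j) := by
              gcongr
              nlinarith [sq_nonneg (‖b k‖ - ‖b j‖)]
          _ = _ := by ring
    _ = C * ((∑ k ∈ s, ∑ j ∈ s.erase k, w k j * ‖b k‖^2 +
          ∑ k ∈ s, ∑ j ∈ s.erase k, w k j * ‖b j‖^2) / 2) := by
        simp_rw [← Finset.mul_sum, ← Finset.sum_div, Finset.sum_add_distrib]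
    _ ≤ C * ∑ k ∈ s, ‖b k‖^2 := by
        rw [hswap]
        gcongr
        linarith

lemma ing_shift (γ T p : ℝ) (hγ : 0 < γ) (hT0 : 0 < T) (hp : p = Real.pi / T) (hpγ : 2 * p < γ)
    (ω : ℤ → ℝ) (hgap : ∀ k : ℤ, ω (k + 1) - ω k ≥ γ) (s : Finset ℤ) (a : ℤ → ℂ) (c : ℝ) :
    |(∫ t in (-(T/2))..(T/2), Real.cos (p * t) *
      ‖∑ k ∈ s, a k * Complex.exp (Complex.I * (ω k : ℂ) * ((t + c : ℝ) : ℂ))‖ ^ 2)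
      - 2 / p * ∑ k ∈ s, ‖a k‖^2| ≤ 8 * p / γ^2 * ∑ k ∈ s, ‖a k‖^2 := by
  have h := ing_main γ T p hγ hT0 hp hpγ ω hgap s
    (fun k => a k * Complex.exp (Complex.I * (ω k : ℂ) * (c : ℂ)))
  simp_rw [norm_mul, ing_exp_norm, mul_one] at h
  convert h using 8 with t
  refine Finset.sum_congr rfl fun k _ => ?_
  rw [mul_assoc (a k), ← Complex.exp_add]
  congr 2
  push_cast
  ring

/-- Ingham's theorem with explicit constants (Lemma 2.1 of the paper). -/
theorem ingham_inequality (γ T : ℝ) (hγ : 0 < γ) (hT : T > 2 * Real.pi / γ)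
    (ω : ℤ → ℝ) (hmono : StrictMono ω) (hgap : ∀ k : ℤ, ω (k + 1) - ω k ≥ γ)
    (a : ℤ → ℂ) (ha : (Function.support a).Finite) :
    (2 * T / Real.pi) * (1 - 4 * Real.pi ^ 2 / (T ^ 2 * γ ^ 2)) * (∑ᶠ k : ℤ, ‖a k‖ ^ 2) ≤
      (∫ t in (0:ℝ)..T, ‖∑ᶠ k : ℤ, a k * Complex.exp (Complex.I * (ω k : ℂ) * (t : ℂ))‖ ^ 2) ∧
    (∫ t in (0:ℝ)..T, ‖∑ᶠ k : ℤ, a k * Complex.exp (Complex.I * (ω k : ℂ) * (t : ℂ))‖ ^ 2) ≤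
      (8 * T / Real.pi) * (1 + 4 * Real.pi ^ 2 / (T ^ 2 * γ ^ 2)) * (∑ᶠ k : ℤ, ‖a k‖ ^ 2) := by
  have hpi := Real.pi_pos
  have hT0 : 0 < T := lt_trans (by positivity) hT
  obtain ⟨p, hp⟩ : ∃ p, p = Real.pi / T := ⟨_, rfl⟩
  have hp0 : 0 < p := by rw [hp]; positivity
  have hpγ : 2 * p < γ := by
    rw [gt_iff_lt, div_lt_iff₀ hγ] at hT
    rw [hp, ← mul_div_assoc, div_lt_iff₀ hT0]
    linarith
  set s := ha.toFinset with hs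
  have e1 : ∑ᶠ k : ℤ, ‖a k‖ ^ 2 = ∑ k ∈ s, ‖a k‖^2 := by
    apply finsum_eq_sum_of_support_subset
    intro k hk
    simp only [Function.mem_support] at hk
    simp only [hs, Set.Finite.coe_toFinset, Function.mem_support]
    intro h; simp [h] at hk
  have e2 : ∀ t : ℝ, ∑ᶠ k : ℤ, a k * Complex.exp (Complex.I * (ω k : ℂ) * (t : ℂ)) =
      ∑ k ∈ s, a k * Complex.exp (Complex.I * (ω k : ℂ) * (t : ℂ)) := by
    intro t
    apply finsum_eq_sum_of_support_subset
    intro k hk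
    simp only [Function.mem_support] at hk
    simp only [hs, Set.Finite.coe_toFinset, Function.mem_support]
    intro h; simp [h] at hk
  simp_rw [e1, e2]
  have hsh := ing_shift γ T p hγ hT0 hp hpγ ω hgap s a
  set S := ∑ k ∈ s, ‖a k‖^2 with hS
  set f : ℝ → ℝ := fun t => ‖∑ k ∈ s, a k * Complex.exp (Complex.I * (ω k : ℂ) * (t : ℂ))‖^2 with hf
  have hfc : Continuous f := by simp only [hf]; fun_prop
  have hf0 : ∀ t, 0 ≤ f t := fun t => by simp only [hf]; positivity
  change ∀ c, |(∫ t in (-(T/2))..(T/2), Real.cos (p * t) * f (t + c)) - 2 / p * S| ≤ _ at hsh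
  have k1 : (2 * T / Real.pi) * (1 - 4 * Real.pi ^ 2 / (T ^ 2 * γ ^ 2)) * S =
      2 / p * S - 8 * p / γ^2 * S := by rw [hp]; field_simp; ring
  have k2 : (8 * T / Real.pi) * (1 + 4 * Real.pi ^ 2 / (T ^ 2 * γ ^ 2)) * S =
      4 * (2 / p * S + 8 * p / γ^2 * S) := by rw [hp]; field_simp; ring
  have hpT : p * T = Real.pi := by rw [hp]; field_simp
  have hcos : ∀ t ∈ Set.Icc (-(T/2)) (T/2), 0 ≤ Real.cos (p * t) := by
    intro t ht
    apply Real.cos_nonneg_of_mem_Icc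
    constructor <;> nlinarith [ht.1, ht.2]
  have hcos2 : ∀ t ∈ Set.Icc (-(T/4)) (T/4), 1 ≤ 2 * Real.cos (p * t) := by
    intro t ht
    have h1 := Real.one_sub_sq_div_two_le_cos (x := p * t)
    have h2 : |p * t| ≤ 1 := by
      have := Real.pi_lt_d2
      rw [abs_le]
      constructor <;> nlinarith [ht.1, ht.2]
    have h3 : (p*t)^2 ≤ 1 := (sq_le_one_iff_abs_le_one _).2 h2
    linarith
  constructor
  · change _ ≤ ∫ t in (0:ℝ)..T, f t
    have h1 : ∫ t in (0:ℝ)..T, f t = ∫ t in (-(T/2))..(T/2), f (t + T/2) := by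
      rw [intervalIntegral.integral_comp_add_right]
      congr 1 <;> ring
    have h2 : (∫ t in (-(T/2))..(T/2), Real.cos (p * t) * f (t + T/2)) ≤
        ∫ t in (-(T/2))..(T/2), f (t + T/2) := by
      apply intervalIntegral.integral_mono_on (by linarith)
      · apply Continuous.intervalIntegrable; fun_prop
      · apply Continuous.intervalIntegrable; fun_prop
      · intro t _
        exact mul_le_of_le_one_left (hf0 _) (Real.cos_le_one _)
    rw [k1, h1]
    have := (abs_le.1 (hsh (T/2))).1
    linarith
  · change (∫ t in (0:ℝ)..T, f t) ≤ _
    have key : ∀ c, (∫ t in (-(T/4))..(T/4), f (t + c)) ≤ 2 * (2 / p * S + 8 * p / γ^2 * S) := by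
      intro c
      have g1 : (∫ t in (-(T/4))..(T/4), f (t + c)) ≤
          ∫ t in (-(T/4))..(T/4), 2 * (Real.cos (p * t) * f (t + c)) := by
        apply intervalIntegral.integral_mono_on (by linarith)
        · apply Continuous.intervalIntegrable; fun_prop
        · apply Continuous.intervalIntegrable; fun_prop
        · intro t ht
          have := mul_le_mul_of_nonneg_right (hcos2 t ht) (hf0 (t + c))
          linarith
      have g2 : (∫ t in (-(T/4))..(T/4), Real.cos (p * t) * f (t + c)) ≤
          ∫ t in (-(T/2))..(T/2), Real.cos (p * t) * f (t + c) := by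
        apply intervalIntegral.integral_mono_interval (by linarith) (by linarith) (by linarith)
        · filter_upwards [ae_restrict_mem measurableSet_Ioc] with t ht
          exact mul_nonneg (hcos t ⟨ht.1.le, ht.2⟩) (hf0 _)
        · apply Continuous.intervalIntegrable; fun_prop
      rw [intervalIntegral.integral_const_mul] at g1
      have := (abs_le.1 (hsh c)).2
      linarith
    have i1 := key (T/4)
    have i2 := key (3*T/4)
    rw [intervalIntegral.integral_comp_add_right] at i1 i2
    rw [show -(T/4) + T/4 = 0 by ring, show T/4 + T/4 = T/2 by ring] at i1
    rw [show -(T/4) + 3*T/4 = T/2 by ring, show T/4 + 3*T/4 = T by ring] at i2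
    rw [← intervalIntegral.integral_add_adjacent_intervals (b := T/2)
      (hfc.intervalIntegrable _ _) (hfc.intervalIntegrable _ _), k2]
    linarith
end

section
/- Let L > 0, f ∈ ℝ, and let μ : ℕ → ℝ be strictly increasing with μ_{n+1} − μ_n ≥ 2π/L for all n. Let c : ℕ → ℂ be finitely supported, and define y(t) = e^{f t} · Σ_{n} c_n e^{i μ_n t}. Then for all T₁ < T₂ with T₂ − T₁ > L, ∫_{T₁}^{T₂} |y(t)|² dt ≥ min(e^{2 f T₁}, e^{2 f T₂}) · (2(T₂−T₁)/π) · (1 − L²/(T₂−T₁)²) · Σ_n |c_n|². In particular, if some c_n ≠ 0 then ∫_{T₁}^{T₂} |y(t)|² dt > 0. -/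
open MeasureTheory

noncomputable def ingG (m n : ℕ) : ℝ := if n = m then 0 else 1 / (((n:ℝ) - m)^2 - 1/4)

lemma ingG_symm (m n : ℕ) : ingG m n = ingG n m := by
  unfold ingG
  by_cases h : n = m
  · simp [h]
  · rw [if_neg h, if_neg (Ne.symm h)]
    congr 2; ring

lemma ing_sq_ge {m n : ℕ} (h : n ≠ m) : (1:ℝ) ≤ ((n:ℝ) - m)^2 := by
  have h1 : (1:ℤ) ≤ ((n:ℤ) - m)^2 := by
    have : ((n:ℤ) - m) ≠ 0 := by omega
    have := sq_pos_of_ne_zero this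
    omega
  exact_mod_cast h1

lemma ingG_nonneg (m n : ℕ) : 0 ≤ ingG m n := by
  unfold ingG
  split_ifs with h
  · exact le_rfl
  · have := ing_sq_ge h
    apply div_nonneg <;> linarith

lemma ingG_range (m N : ℕ) : ∑ n ∈ Finset.range N, ingG m n ≤
    if N ≤ m then 1 / ((m:ℝ) - N + 1/2) else 4 - 1 / ((N:ℝ) - m - 1/2) := by
  induction N with
  | zero => simp; positivity
  | succ N ih =>
    rw [Finset.sum_range_succ]
    rcases lt_trichotomy N m with h | h | h
    · rw [if_pos h.le] at ih
      rw [if_pos (by omega)]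
      have hg : ingG m N = 1 / ((m:ℝ) - (N+1:ℕ) + 1/2) - 1 / ((m:ℝ) - N + 1/2) := by
        unfold ingG
        rw [if_neg h.ne]
        have : (N:ℝ) + 1 ≤ m := by exact_mod_cast h
        push_cast
        have h1 : (m:ℝ) - (N+1) + 1/2 ≠ 0 := by linarith
        have h2 : (m:ℝ) - N + 1/2 ≠ 0 := by linarith
        have h3 : ((N:ℝ) - m)^2 - 1/4 = ((m:ℝ) - (N+1) + 1/2) * ((m:ℝ) - N + 1/2) := by ring
        rw [h3, div_sub_div _ _ h1 h2]
        congr 1; ring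
      linarith
    · subst h
      simp only [le_refl, if_true] at ih
      rw [if_neg (by omega)]
      have : ingG N N = 0 := by simp [ingG]
      rw [this]
      push_cast
      norm_num at ih ⊢
      linarith
    · rw [if_neg (by omega)] at ih
      rw [if_neg (by omega)]
      have hg : ingG m N = 1 / ((N:ℝ) - m - 1/2) - 1 / (((N+1:ℕ):ℝ) - m - 1/2) := by
        unfold ingG
        rw [if_neg h.ne']
        have : (m:ℝ) + 1 ≤ N := by exact_mod_cast h
        push_cast
        have h1 : (N:ℝ) - m - 1/2 ≠ 0 := by linarith
        have h2 : (N:ℝ) + 1 - m - 1/2 ≠ 0 := by linarith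
        have h3 : ((N:ℝ) - m)^2 - 1/4 = ((N:ℝ) - m - 1/2) * ((N:ℝ) + 1 - m - 1/2) := by ring
        rw [h3, div_sub_div _ _ h1 h2]
        congr 1; ring
      linarith

lemma ingG_sum (m : ℕ) (S : Finset ℕ) : ∑ n ∈ S, ingG m n ≤ 4 := by
  obtain ⟨N, hN⟩ := S.exists_nat_subset_range
  calc ∑ n ∈ S, ingG m n ≤ ∑ n ∈ Finset.range (N + m + 1), ingG m n := by
        apply Finset.sum_le_sum_of_subset_of_nonneg
        · intro x hx
          have := Finset.mem_range.1 (hN hx)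
          exact Finset.mem_range.2 (by omega)
        · intros; exact ingG_nonneg _ _
    _ ≤ _ := ingG_range m _
    _ ≤ 4 := by
        rw [if_neg (by omega)]
        have : 0 ≤ 1 / (((N + m + 1 : ℕ):ℝ) - m - 1/2) := by
          push_cast
          apply div_nonneg zero_le_one
          have : (0:ℝ) ≤ N := by positivity
          linarith
        linarith

noncomputable def ingK (T₁ T₂ u : ℝ) : ℂ :=
  ∫ t in T₁..T₂, (Real.sin (Real.pi / (T₂ - T₁) * (t - T₁)) : ℂ) * Complex.exp (Complex.I * u * t)

lemma ingK_eq (T₁ T₂ u : ℝ) (h12 : T₁ < T₂) (hu : u^2 ≠ (Real.pi / (T₂ - T₁))^2) :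
    ingK T₁ T₂ u = (Real.pi / (T₂ - T₁) : ℝ) *
      (Complex.exp (Complex.I * u * T₂) + Complex.exp (Complex.I * u * T₁)) /
      (((Real.pi / (T₂ - T₁))^2 - u^2 : ℝ) : ℂ) := by
  unfold ingK
  have haT : Real.pi / (T₂ - T₁) * (T₂ - T₁) = Real.pi := by
    have : T₂ - T₁ ≠ 0 := by linarith
    field_simp
  generalize Real.pi / (T₂ - T₁) = a at *
  have hne : ((a^2 - u^2 : ℝ) : ℂ) ≠ 0 := by
    exact_mod_cast sub_ne_zero.2 hu.symm
  have key : ∀ t : ℝ, HasDerivAt (fun t : ℝ => Complex.exp (Complex.I * u * t) *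
      (Complex.I * u * (Real.sin (a * (t - T₁)) : ℝ) - a * (Real.cos (a * (t - T₁)) : ℝ)) /
        ((a^2 - u^2 : ℝ) : ℂ))
      ((Real.sin (a * (t - T₁)) : ℂ) * Complex.exp (Complex.I * u * t)) t := by
    intro t
    have hl : HasDerivAt (fun t : ℝ => a * (t - T₁)) a t := by
      simpa using ((hasDerivAt_id t).sub_const T₁).const_mul a
    have hs := hl.sin.ofReal_comp
    have hcos := hl.cos.ofReal_comp
    have hid : HasDerivAt (fun t : ℝ => (t : ℂ)) 1 t := by
      simpa using (hasDerivAt_id t).ofReal_comp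
    have he := (hid.const_mul (Complex.I * u)).cexp
    have := (he.mul ((hs.const_mul (Complex.I * u)).sub (hcos.const_mul (a:ℂ)))).div_const
      ((a^2 - u^2 : ℝ) : ℂ)
    refine this.congr_deriv ?_
    rw [div_eq_iff hne]
    simp only [Pi.sub_apply]
    push_cast
    linear_combination (Complex.exp (Complex.I * u * t) * u^2 * Complex.sin (a * (t - T₁))) * Complex.I_sq
  rw [intervalIntegral.integral_eq_sub_of_hasDerivAt (fun t _ => key t)
    (by apply Continuous.intervalIntegrable; fun_prop)]
  rw [haT]
  simp only [sub_self, mul_zero, Real.sin_pi, Real.cos_pi, Real.sin_zero, Real.cos_zero]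
  rw [← sub_div]
  congr 1
  push_cast
  ring

lemma ingK_zero (T₁ T₂ : ℝ) (h12 : T₁ < T₂) : ingK T₁ T₂ 0 = (2 * (T₂ - T₁) / Real.pi : ℝ) := by
  have hT : T₂ - T₁ ≠ 0 := by linarith
  have hp := Real.pi_ne_zero
  rw [ingK_eq T₁ T₂ 0 h12 (by have : (Real.pi / (T₂ - T₁))^2 ≠ 0 := by positivity
                              simpa using this.symm)]
  simp only [Complex.ofReal_zero, mul_zero, zero_mul, Complex.exp_zero]
  norm_cast
  field_simp
  norm_num

lemma ingK_norm (T₁ T₂ u : ℝ) (h12 : T₁ < T₂) (hu : (Real.pi / (T₂ - T₁))^2 < u^2) :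
    ‖ingK T₁ T₂ u‖ ≤ 2 * (Real.pi / (T₂ - T₁)) / (u^2 - (Real.pi / (T₂ - T₁))^2) := by
  rw [ingK_eq T₁ T₂ u h12 hu.ne']
  have ha : 0 < Real.pi / (T₂ - T₁) := div_pos Real.pi_pos (by linarith)
  have hn : ∀ t : ℝ, ‖Complex.exp (Complex.I * u * t)‖ = 1 := by
    intro t
    rw [Complex.norm_exp]; simp
  generalize Real.pi / (T₂ - T₁) = a at *
  rw [norm_div, norm_mul, Complex.norm_real, Complex.norm_real, Real.norm_eq_abs, Real.norm_eq_abs,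
    abs_of_pos ha, abs_of_neg (by linarith : a^2 - u^2 < 0), neg_sub]
  have : ‖Complex.exp (Complex.I * u * T₂) + Complex.exp (Complex.I * u * T₁)‖ ≤ 2 := by
    refine (norm_add_le _ _).trans ?_
    rw [hn, hn]; norm_num
  apply div_le_div_of_nonneg_right _ (by linarith)
  nlinarith

lemma ing_gap_s3 (g : ℝ) (μ : ℕ → ℝ) (hgap : ∀ n : ℕ, μ (n + 1) - μ n ≥ g) (m k : ℕ) :
    k * g ≤ μ (m + k) - μ m := by
  induction k with
  | zero => simp
  | succ k ih =>
    have := hgap (m + k)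
    rw [← add_assoc]
    push_cast
    linarith

lemma ing_gap_sq (g : ℝ) (hg : 0 < g) (μ : ℕ → ℝ) (hgap : ∀ n : ℕ, μ (n + 1) - μ n ≥ g)
    (m n : ℕ) : g^2 * ((n:ℝ) - m)^2 ≤ (μ m - μ n)^2 := by
  wlog h : m ≤ n generalizing m n
  · have := this n m (by omega)
    nlinarith
  · obtain ⟨k, rfl⟩ := Nat.exists_eq_add_of_le h
    have := ing_gap_s3 g μ hgap m k
    have hk : (0:ℝ) ≤ k * g := by positivity
    push_cast
    nlinarith

lemma ing_off (L : ℝ) (hL : 0 < L) (μ : ℕ → ℝ)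
    (hgap : ∀ n : ℕ, μ (n + 1) - μ n ≥ 2 * Real.pi / L)
    (T₁ T₂ : ℝ) (h12 : T₁ < T₂) (hwin : T₂ - T₁ > L) (m n : ℕ) (h : n ≠ m) :
    ‖ingK T₁ T₂ (μ m - μ n)‖ ≤ L^2 / (2 * Real.pi * (T₂ - T₁)) * ingG m n := by
  have hp := Real.pi_pos
  have hsq := ing_gap_sq (2 * Real.pi / L) (by positivity) μ hgap m n
  have h1 := ing_sq_ge h
  unfold ingG
  rw [if_neg h]
  generalize μ m - μ n = u at *
  generalize ((n:ℝ) - m)^2 = r at *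
  have hnorm := ingK_norm T₁ T₂ u h12
  have hT : 0 < T₂ - T₁ := by linarith
  generalize ingK T₁ T₂ u = K at *
  generalize T₂ - T₁ = T at *
  have ha : (Real.pi / T)^2 ≤ (2 * Real.pi / L)^2 * (1/4) := by
    have : Real.pi / T ≤ Real.pi / L := div_le_div_of_nonneg_left hp.le hL hwin.le
    have h0 : 0 < Real.pi / T := by positivity
    have : (Real.pi / T)^2 ≤ (Real.pi / L)^2 := pow_le_pow_left₀ h0.le this 2
    have e : (2 * Real.pi / L)^2 * (1/4) = (Real.pi / L)^2 := by ring
    linarith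
  have hg : 0 < (2 * Real.pi / L)^2 := by positivity
  have hlow : (2 * Real.pi / L)^2 * (r - 1/4) ≤ u^2 - (Real.pi / T)^2 := by linarith
  have hpos : 0 < (2 * Real.pi / L)^2 * (r - 1/4) := by
    apply mul_pos hg; linarith
  refine (hnorm (by linarith)).trans ?_
  refine (div_le_div_of_nonneg_left (by positivity) hpos hlow).trans (le_of_eq ?_)
  have : r - 1/4 ≠ 0 := by linarith
  generalize r - 1/4 = s at *
  field_simp

lemma ing_main_s3 (L : ℝ) (hL : 0 < L) (μ : ℕ → ℝ)
    (hgap : ∀ n : ℕ, μ (n + 1) - μ n ≥ 2 * Real.pi / L)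
    (c : ℕ → ℂ) (S : Finset ℕ)
    (T₁ T₂ : ℝ) (h12 : T₁ < T₂) (hwin : T₂ - T₁ > L) :
    ((2 * (T₂ - T₁) / Real.pi) * (1 - L ^ 2 / (T₂ - T₁) ^ 2)) * (∑ n ∈ S, ‖c n‖ ^ 2) ≤
      ∫ t in T₁..T₂, Real.sin (Real.pi / (T₂ - T₁) * (t - T₁)) *
        ‖∑ n ∈ S, c n * Complex.exp (Complex.I * (μ n : ℂ) * (t : ℂ))‖^2 := by
  have hp := Real.pi_pos
  have hT : 0 < T₂ - T₁ := by linarith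
  have hexp : ((∫ t in T₁..T₂, Real.sin (Real.pi / (T₂ - T₁) * (t - T₁)) *
        ‖∑ n ∈ S, c n * Complex.exp (Complex.I * (μ n : ℂ) * (t : ℂ))‖^2 : ℝ) : ℂ) =
      ∑ m ∈ S, ∑ n ∈ S, c m * (starRingEnd ℂ) (c n) * ingK T₁ T₂ (μ m - μ n) := by
    rw [← intervalIntegral.integral_ofReal]
    unfold ingK
    simp_rw [← intervalIntegral.integral_const_mul]
    have e : ∀ m ∈ S, ∑ n ∈ S, (∫ t in T₁..T₂, c m * (starRingEnd ℂ) (c n) *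
        ((Real.sin (Real.pi / (T₂ - T₁) * (t - T₁)) : ℂ) *
          Complex.exp (Complex.I * ((μ m - μ n : ℝ) : ℂ) * t))) =
        ∫ t in T₁..T₂, ∑ n ∈ S, c m * (starRingEnd ℂ) (c n) *
        ((Real.sin (Real.pi / (T₂ - T₁) * (t - T₁)) : ℂ) *
          Complex.exp (Complex.I * ((μ m - μ n : ℝ) : ℂ) * t)) := by
      intro m _
      rw [intervalIntegral.integral_finsetSum]
      intro n _
      apply Continuous.intervalIntegrable; fun_prop
    rw [Finset.sum_congr rfl e, ← intervalIntegral.integral_finsetSum]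
    swap
    · intro n _
      apply Continuous.intervalIntegrable; fun_prop
    congr 1
    ext t
    rw [Complex.ofReal_mul, Complex.ofReal_pow, ← Complex.mul_conj', map_sum, Finset.sum_mul_sum,
      Finset.mul_sum]
    refine Finset.sum_congr rfl fun m _ => ?_
    rw [Finset.mul_sum]
    refine Finset.sum_congr rfl fun n _ => ?_
    have : Complex.exp (Complex.I * ((μ m - μ n : ℝ) : ℂ) * t) =
        Complex.exp (Complex.I * μ m * t) * (starRingEnd ℂ) (Complex.exp (Complex.I * μ n * t)) := by
      rw [← Complex.exp_conj, ← Complex.exp_add]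
      congr 1
      simp
      ring
    rw [this, map_mul]
    ring
  have hre := congrArg Complex.re hexp
  rw [Complex.ofReal_re] at hre
  rw [hre, Complex.re_sum]
  simp_rw [Complex.re_sum]
  set A := L^2 / (2 * Real.pi * (T₂ - T₁)) with hA
  set D := 2 * (T₂ - T₁) / Real.pi with hD
  have hA0 : 0 ≤ A := by positivity
  have hterm : ∀ m n, (if m = n then D * ‖c m‖^2 else 0)
      - (‖c m‖^2 * (A/2 * ingG m n) + ‖c n‖^2 * (A/2 * ingG n m)) ≤
      (c m * (starRingEnd ℂ) (c n) * ingK T₁ T₂ (μ m - μ n)).re := by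
    intro m n
    by_cases h : m = n
    · subst h
      rw [if_pos rfl, sub_self, ingK_zero _ _ h12, Complex.mul_conj', ← hD]
      have : ingG m m = 0 := by simp [ingG]
      rw [this]
      norm_cast
      simp [mul_comm]
    · rw [if_neg h]
      have hK := ing_off L hL μ hgap T₁ T₂ h12 hwin m n (Ne.symm h)
      rw [← hA] at hK
      have h1 := (abs_le.1 (Complex.abs_re_le_norm
        (c m * (starRingEnd ℂ) (c n) * ingK T₁ T₂ (μ m - μ n)))).1
      rw [norm_mul, norm_mul, Complex.norm_conj] at h1
      have h2 : ‖c m‖ * ‖c n‖ * ‖ingK T₁ T₂ (μ m - μ n)‖ ≤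
        ((‖c m‖^2 + ‖c n‖^2)/2) * (A * ingG m n) := by
        apply mul_le_mul _ hK (norm_nonneg _) (by positivity)
        nlinarith [sq_nonneg (‖c m‖ - ‖c n‖)]
      rw [ingG_symm n m]
      linarith
  refine le_trans ?_ (Finset.sum_le_sum fun m _ => Finset.sum_le_sum fun n _ => hterm m n)
  simp_rw [Finset.sum_sub_distrib, Finset.sum_add_distrib]
  rw [Finset.sum_comm (f := fun m n => ‖c n‖^2 * (A/2 * ingG n m))]
  have hd : ∑ m ∈ S, ∑ n ∈ S, (if m = n then D * ‖c m‖^2 else 0) = D * ∑ m ∈ S, ‖c m‖^2 := by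
    rw [Finset.mul_sum]
    refine Finset.sum_congr rfl fun m hm => ?_
    rw [Finset.sum_ite_eq, if_pos hm]
  have ho : ∑ m ∈ S, ∑ n ∈ S, ‖c m‖^2 * (A/2 * ingG m n) ≤ 2 * A * ∑ m ∈ S, ‖c m‖^2 := by
    rw [Finset.mul_sum]
    refine Finset.sum_le_sum fun m hm => ?_
    rw [← Finset.mul_sum, ← Finset.mul_sum]
    have := mul_le_mul_of_nonneg_left (ingG_sum m S) (by positivity : 0 ≤ ‖c m‖^2 * (A/2))
    linarith
  rw [hd]
  have hDA : D * (1 - L ^ 2 / (T₂ - T₁) ^ 2) = D - 4 * A := by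
    rw [hD, hA]
    field_simp
    ring
  rw [hDA]
  linarith


/-- Lower bound on the windowed `L²` norm of the output in terms of the `ℓ²` norm of the
modal coefficients (equations (2.16)–(2.18) of the paper). -/
theorem windowed_norm_lower_bound (L : ℝ) (hL : 0 < L) (f : ℝ) (μ : ℕ → ℝ)
    (hmono : StrictMono μ) (hgap : ∀ n : ℕ, μ (n + 1) - μ n ≥ 2 * Real.pi / L)
    (c : ℕ → ℂ) (hc : (Function.support c).Finite)
    (y : ℝ → ℂ)
    (hy : ∀ t : ℝ, y t = Complex.exp ((f : ℂ) * (t : ℂ)) *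
      ∑ᶠ n : ℕ, c n * Complex.exp (Complex.I * (μ n : ℂ) * (t : ℂ)))
    (T₁ T₂ : ℝ) (h12 : T₁ < T₂) (hwin : T₂ - T₁ > L) :
    min (Real.exp (2 * f * T₁)) (Real.exp (2 * f * T₂)) *
        ((2 * (T₂ - T₁) / Real.pi) * (1 - L ^ 2 / (T₂ - T₁) ^ 2)) * (∑ᶠ n : ℕ, ‖c n‖ ^ 2) ≤
      (∫ t in T₁..T₂, ‖y t‖ ^ 2) ∧
    ((∃ n, c n ≠ 0) → 0 < ∫ t in T₁..T₂, ‖y t‖ ^ 2) := by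

  have hp := Real.pi_pos
  have hT : 0 < T₂ - T₁ := by linarith
  have hS : ∀ t : ℝ, y t = Complex.exp ((f : ℂ) * (t : ℂ)) *
      ∑ n ∈ hc.toFinset, c n * Complex.exp (Complex.I * (μ n : ℂ) * (t : ℂ)) := by
    intro t
    rw [hy, finsum_eq_sum_of_support_subset]
    intro n hn
    simp only [Function.mem_support, Set.Finite.coe_toFinset] at hn ⊢
    exact left_ne_zero_of_mul hn
  have hsum : ∑ᶠ n : ℕ, ‖c n‖ ^ 2 = ∑ n ∈ hc.toFinset, ‖c n‖^2 := by
    apply finsum_eq_sum_of_support_subset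
    intro n hn
    simp only [Function.mem_support, Set.Finite.coe_toFinset] at hn ⊢
    intro h; simp [h] at hn
  have hM : 0 < min (Real.exp (2 * f * T₁)) (Real.exp (2 * f * T₂)) :=
    lt_min (Real.exp_pos _) (Real.exp_pos _)
  have hmain : min (Real.exp (2 * f * T₁)) (Real.exp (2 * f * T₂)) *
        ((2 * (T₂ - T₁) / Real.pi) * (1 - L ^ 2 / (T₂ - T₁) ^ 2)) * (∑ᶠ n : ℕ, ‖c n‖ ^ 2) ≤
      (∫ t in T₁..T₂, ‖y t‖ ^ 2) := by
    rw [hsum, mul_assoc]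
    refine (mul_le_mul_of_nonneg_left
      (ing_main_s3 L hL μ hgap c hc.toFinset T₁ T₂ h12 hwin) hM.le).trans ?_
    rw [← intervalIntegral.integral_const_mul]
    have hyc : Continuous y := by
      rw [funext hS]; fun_prop
    apply intervalIntegral.integral_mono_on h12.le
    · apply Continuous.intervalIntegrable; fun_prop
    · apply Continuous.intervalIntegrable; fun_prop
    intro t ht
    rw [hS t, norm_mul, mul_pow, ← mul_assoc]
    apply mul_le_mul_of_nonneg_right _ (by positivity)
    have he : ‖Complex.exp ((f : ℂ) * (t : ℂ))‖^2 = Real.exp (2 * f * t) := by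
      rw [Complex.norm_exp, ← Real.exp_nat_mul]
      congr 1
      simp
      ring
    rw [he]
    have h1 : min (Real.exp (2 * f * T₁)) (Real.exp (2 * f * T₂)) ≤ Real.exp (2 * f * t) := by
      rcases le_total 0 f with h | h
      · exact (min_le_left _ _).trans (Real.exp_le_exp.2 (by nlinarith [ht.1]))
      · exact (min_le_right _ _).trans (Real.exp_le_exp.2 (by nlinarith [ht.2]))
    exact (mul_le_of_le_one_right hM.le (Real.sin_le_one _)).trans h1
  refine ⟨hmain, fun ⟨n, hn⟩ => lt_of_lt_of_le ?_ hmain⟩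
  have hfac : 0 < 1 - L ^ 2 / (T₂ - T₁) ^ 2 := by
    rw [sub_pos, div_lt_one (by positivity)]
    exact pow_lt_pow_left₀ hwin hL.le (by norm_num)
  have hs : 0 < ∑ᶠ n : ℕ, ‖c n‖ ^ 2 := by
    rw [hsum]
    refine Finset.sum_pos' (fun _ _ => by positivity) ⟨n, by simpa using hn, ?_⟩
    have := norm_pos_iff.2 hn
    positivity
  positivity
end

section
/- Let q ∈ ℝ with q > 0, and for each positive integer n set λ_n = q + i (n − 1/2)² π². Let a : ℕ → ℂ satisfy Σ_{n≥1} |a_n| < ∞ with a not identically zero, let y_e(t) = Σ_{n≥1} a_n e^{λ_n t}, let d : ℝ → ℂ be measurable with |d(t)| ≤ M for all t and some M ≥ 0, and set y = y_e + d. Fix c > 8/π and for T ∈ ℝ define q_T = (π/8) · ln( ‖y‖_{L²(T,T+c)} / ‖y‖_{L²(T−8/π, T+c−8/π)} ). Then q_T → q as T → +∞. -/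
open MeasureTheory

theorem aux_ratio (q : ℝ) (hq : 0 < q) (L c M A : ℝ) (hL : 0 < L) (hc : L < c)
    (p d : ℝ → ℂ) (hp : Continuous p) (hper : Function.Periodic p L)
    (hpA : ∀ t, ‖p t‖ ≤ A) (hd : Measurable d) (hdM : ∀ t, ‖d t‖ ≤ M)
    (hK : 0 < ∫ t in (0:ℝ)..L, ‖p t‖ ^ 2) :
    Filter.Tendsto (fun T : ℝ =>
      (∫ t in T..(T + c), ‖(Real.exp (q * t) : ℂ) * p t + d t‖ ^ 2) /
        (∫ t in T..(T + c), ‖(Real.exp (q * t) : ℂ) * p t‖ ^ 2))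
      Filter.atTop (nhds 1) ∧
    (∀ T : ℝ, 0 < ∫ t in T..(T + c), ‖(Real.exp (q * t) : ℂ) * p t‖ ^ 2) := by
  have hM : 0 ≤ M := (norm_nonneg _).trans (hdM 0)
  have hA : 0 ≤ A := (norm_nonneg _).trans (hpA 0)
  set K := ∫ t in (0:ℝ)..L, ‖p t‖ ^ 2 with hKdef
  have hcont : Continuous fun t : ℝ => ‖(Real.exp (q * t) : ℂ) * p t‖ ^ 2 := by fun_prop
  have hnorm : ∀ t : ℝ, ‖(Real.exp (q * t) : ℂ) * p t‖ = Real.exp (q * t) * ‖p t‖ := by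
    intro t
    rw [norm_mul, Complex.norm_real, Real.norm_of_nonneg (Real.exp_pos _).le]
  have hcp : Continuous fun t : ℝ => ‖p t‖ ^ 2 := by fun_prop
  have hE : ∀ T : ℝ, Real.exp (q * T) ^ 2 * K ≤
      ∫ t in T..(T + c), ‖(Real.exp (q * t) : ℂ) * p t‖ ^ 2 := by
    intro T
    have h1 : K = ∫ t in T..(T + L), ‖p t‖ ^ 2 := by
      have hper2 : Function.Periodic (fun t => ‖p t‖ ^ 2) L := by
        intro t; simp only [hper t]
      have := hper2.intervalIntegral_add_eq 0 T
      simpa using this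
    have h2 : (∫ t in T..(T + L), ‖p t‖ ^ 2) ≤ ∫ t in T..(T + c), ‖p t‖ ^ 2 := by
      apply intervalIntegral.integral_mono_interval le_rfl (by linarith) (by linarith)
      · exact Filter.Eventually.of_forall fun t => by positivity
      · exact hcp.intervalIntegrable _ _
    calc Real.exp (q * T) ^ 2 * K ≤ Real.exp (q * T) ^ 2 * ∫ t in T..(T + c), ‖p t‖ ^ 2 := by
          rw [h1]; gcongr
      _ = ∫ t in T..(T + c), Real.exp (q * T) ^ 2 * ‖p t‖ ^ 2 := by
          rw [intervalIntegral.integral_const_mul]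
      _ ≤ _ := by
          apply intervalIntegral.integral_mono_on (by linarith)
          · exact (by fun_prop : Continuous fun t : ℝ =>
              Real.exp (q * T) ^ 2 * ‖p t‖ ^ 2).intervalIntegrable _ _
          · exact hcont.intervalIntegrable _ _
          · intro t ht
            rw [hnorm, mul_pow]
            gcongr
            exact ht.1
  have hEpos : ∀ T : ℝ, 0 < ∫ t in T..(T + c), ‖(Real.exp (q * t) : ℂ) * p t‖ ^ 2 :=
    fun T => lt_of_lt_of_le (by positivity) (hE T)
  refine ⟨?_, hEpos⟩
  let r : ℝ → ℝ := fun t => ‖(Real.exp (q * t) : ℂ) * p t + d t‖ ^ 2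
    - ‖(Real.exp (q * t) : ℂ) * p t‖ ^ 2
  have hr : ∀ t, ‖r t‖ ≤ M * (2 * A * Real.exp (q * t) + M) := by
    intro t
    have e1 : ‖(Real.exp (q * t) : ℂ) * p t‖ ≤ A * Real.exp (q * t) := by
      rw [hnorm, mul_comm]; gcongr; exact hpA t
    have e2 := abs_norm_sub_norm_le ((Real.exp (q * t) : ℂ) * p t + d t)
      ((Real.exp (q * t) : ℂ) * p t)
    have e3 := norm_add_le ((Real.exp (q * t) : ℂ) * p t) (d t)
    rw [add_sub_cancel_left] at e2
    have hd' := hdM t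
    have e4 : r t = (‖(Real.exp (q * t) : ℂ) * p t + d t‖ - ‖(Real.exp (q * t) : ℂ) * p t‖) *
      (‖(Real.exp (q * t) : ℂ) * p t + d t‖ + ‖(Real.exp (q * t) : ℂ) * p t‖) := by
      simp only [r]; ring
    rw [e4, Real.norm_eq_abs, abs_mul]
    apply mul_le_mul (e2.trans hd') _ (abs_nonneg _) hM
    rw [abs_of_nonneg (by positivity)]
    linarith
  have hrm : Measurable r := by
    have := hp.measurable
    simp only [r]
    fun_prop
  have hri : ∀ u v : ℝ, IntervalIntegrable r volume u v := by
    intro u v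
    have hg : Continuous fun t : ℝ => M * (2 * A * Real.exp (q * t) + M) := by fun_prop
    exact (hg.intervalIntegrable u v).mono_fun' hrm.aestronglyMeasurable
      (Filter.Eventually.of_forall hr)
  have hJ : ∀ T : ℝ, (∫ t in T..(T + c), ‖(Real.exp (q * t) : ℂ) * p t + d t‖ ^ 2) =
      (∫ t in T..(T + c), ‖(Real.exp (q * t) : ℂ) * p t‖ ^ 2) + ∫ t in T..(T + c), r t := by
    intro T
    rw [← intervalIntegral.integral_add (hcont.intervalIntegrable _ _) (hri _ _)]
    congr 1; ext t; simp only [r]; ring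
  have hR : ∀ T : ℝ, ‖∫ t in T..(T + c), r t‖ ≤
      M * (2 * A * Real.exp (q * (T + c)) + M) * c := by
    intro T
    have := intervalIntegral.norm_integral_le_of_norm_le_const (a := T) (b := T + c) (f := r)
      (C := M * (2 * A * Real.exp (q * (T + c)) + M)) (by
        intro t ht
        rw [Set.uIoc_of_le (by linarith)] at ht
        refine (hr t).trans ?_
        gcongr
        exact ht.2)
    rwa [add_sub_cancel_left, abs_of_pos (by linarith)] at this
  have hexp : Filter.Tendsto (fun T : ℝ => Real.exp (-(q * T))) Filter.atTop (nhds 0) :=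
    Real.tendsto_exp_neg_atTop_nhds_zero.comp (Filter.tendsto_id.const_mul_atTop hq)
  have hlim : Filter.Tendsto (fun T : ℝ => (c * M / K) * (2 * A * Real.exp (q * c) *
      Real.exp (-(q * T)) + M * Real.exp (-(q * T)) ^ 2)) Filter.atTop (nhds 0) := by
    have := (((hexp.const_mul (2 * A * Real.exp (q * c))).add
      ((hexp.pow 2).const_mul M)).const_mul (c * M / K))
    simpa using this
  have hquot : Filter.Tendsto (fun T : ℝ => (∫ t in T..(T + c), r t) /
      (∫ t in T..(T + c), ‖(Real.exp (q * t) : ℂ) * p t‖ ^ 2)) Filter.atTop (nhds 0) := by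
    refine squeeze_zero_norm (fun T => ?_) hlim
    rw [norm_div, Real.norm_of_nonneg (hEpos T).le]
    calc _ ≤ (M * (2 * A * Real.exp (q * (T + c)) + M) * c) / (Real.exp (q * T) ^ 2 * K) := by
          have hcp : 0 ≤ c := by linarith
          apply div_le_div₀ (by positivity) (hR T) (by positivity) (hE T)
      _ = _ := by
          rw [mul_add q, Real.exp_add, Real.exp_neg]
          field_simp
  have := hquot.const_add 1
  rw [add_zero] at this
  refine this.congr fun T => ?_
  rw [hJ, add_div, div_self (hEpos T).ne']

theorem aux_pos (L : ℝ) (hL : 0 < L) (a : ℕ+ → ℂ) (ha : Summable fun n => ‖a n‖) (ha0 : a ≠ 0)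
    (k : ℕ+ → ℤ) (hk : Function.Injective k) (mu : ℕ+ → ℝ)
    (hmu : ∀ n, mu n * L = 2 * Real.pi * k n)
    (p : ℝ → ℂ) (hp : ∀ t, p t = ∑' n, a n * Complex.exp (mu n * t * Complex.I))
    (hpc : Continuous p) :
    0 < ∫ t in (0:ℝ)..L, ‖p t‖ ^ 2 := by
  by_contra hneg
  apply ha0
  have hcp : Continuous fun t : ℝ => ‖p t‖ ^ 2 := by fun_prop
  have hz : ∀ t ∈ Set.Icc 0 L, p t = 0 := by
    intro t ht
    by_contra hne
    apply hneg
    exact intervalIntegral.integral_pos hL hcp.continuousOn (fun x _ => by positivity)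
      ⟨t, ht, by positivity⟩
  ext n
  have key : HasSum (fun m => ∫ t in (0:ℝ)..L, a m * Complex.exp (((mu m - mu n : ℝ) * Complex.I) * t))
      (∫ t in (0:ℝ)..L, ∑' m, a m * Complex.exp (((mu m - mu n : ℝ) * Complex.I) * t)) := by
    apply intervalIntegral.hasSum_integral_of_dominated_convergence (fun m _ => ‖a m‖)
    · intro m
      exact (by fun_prop : Continuous fun t : ℝ =>
        a m * Complex.exp (((mu m - mu n : ℝ) * Complex.I) * t)).aestronglyMeasurable
    · intro m
      refine Filter.Eventually.of_forall fun t _ => ?_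
      rw [norm_mul, mul_right_comm, ← Complex.ofReal_mul, Complex.norm_exp_ofReal_mul_I, mul_one]
    · exact Filter.Eventually.of_forall fun t _ => ha
    · exact intervalIntegrable_const
    · refine Filter.Eventually.of_forall fun t _ => Summable.hasSum ?_
      apply Summable.of_norm
      refine ha.congr fun m => ?_
      rw [norm_mul, mul_right_comm, ← Complex.ofReal_mul, Complex.norm_exp_ofReal_mul_I, mul_one]
  have h0 : (∫ t in (0:ℝ)..L, ∑' m, a m * Complex.exp (((mu m - mu n : ℝ) * Complex.I) * t)) = 0 := by
    refine (intervalIntegral.integral_congr (g := fun _ => (0:ℂ)) ?_).trans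
      intervalIntegral.integral_zero
    intro t ht
    rw [Set.uIcc_of_le hL.le] at ht
    have : (∑' m, a m * Complex.exp (((mu m - mu n : ℝ) * Complex.I) * t))
        = p t * Complex.exp (-(mu n * t * Complex.I)) := by
      rw [hp, ← tsum_mul_right]
      refine tsum_congr fun m => ?_
      rw [mul_assoc (a m), ← Complex.exp_add]
      congr 2; push_cast; ring
    simp only [this, hz t ht, zero_mul]
  rw [h0] at key
  have h1 : ∀ m, m ≠ n → (∫ t in (0:ℝ)..L, a m * Complex.exp (((mu m - mu n : ℝ) * Complex.I) * t)) = 0 := by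
    intro m hm
    have hkmn : ((k m : ℝ) - k n) ≠ 0 := by
      rw [sub_ne_zero]; exact_mod_cast fun h => hm (hk h)
    have hd : (mu m - mu n) * L = 2 * Real.pi * (k m - k n) := by
      rw [sub_mul, hmu, hmu]; ring
    have hne : mu m - mu n ≠ 0 := by
      intro h
      rw [h, zero_mul] at hd
      have : 2 * Real.pi * ((k m : ℝ) - k n) ≠ 0 := mul_ne_zero (by positivity) hkmn
      exact this hd.symm
    have hne' : ((mu m - mu n : ℝ) * Complex.I) ≠ 0 :=
      mul_ne_zero (by exact_mod_cast hne) Complex.I_ne_zero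
    rw [intervalIntegral.integral_const_mul, integral_exp_mul_complex hne']
    have : Complex.exp (((mu m - mu n : ℝ) * Complex.I) * (L : ℂ)) = 1 := by
      rw [Complex.exp_eq_one_iff]
      refine ⟨k m - k n, ?_⟩
      rw [mul_right_comm, ← Complex.ofReal_mul, hd]
      push_cast; ring
    rw [this]; simp
  have h2 := (hasSum_single n h1).unique key
  simp only [sub_self, Complex.ofReal_zero, zero_mul, Complex.exp_zero, mul_one,
    intervalIntegral.integral_const, sub_zero] at h2
  rcases smul_eq_zero.mp h2 with h | h
  · exact absurd h hL.ne'
  · exact h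

/-- Corollary 4.1 of the paper for the Schrödinger equation: the estimator
`q_T = (π/8) ln(‖y‖_{L²(T,T+c)} / ‖y‖_{L²(T−8/π,T+c−8/π)})` computed from the disturbed
output converges to the true anti-damping coefficient `q` as `T → +∞`. -/
theorem schrodinger_disturbed_identification (q : ℝ) (hq : 0 < q)
    (lam : ℕ+ → ℂ)
    (hlam : ∀ n : ℕ+,
      lam n = (q : ℂ) + Complex.I * (((n : ℕ) : ℂ) - 1 / 2) ^ 2 * (Real.pi : ℂ) ^ 2)
    (a : ℕ+ → ℂ) (ha : Summable fun n => ‖a n‖) (ha0 : a ≠ 0)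
    (M : ℝ) (hM : 0 ≤ M)
    (d : ℝ → ℂ) (hdmeas : Measurable d) (hdM : ∀ t : ℝ, ‖d t‖ ≤ M)
    (y : ℝ → ℂ)
    (hy : ∀ t : ℝ, y t = (∑' n : ℕ+, a n * Complex.exp (lam n * (t : ℂ))) + d t)
    (c : ℝ) (hc : 8 / Real.pi < c) :
    Filter.Tendsto
      (fun T : ℝ =>
        (Real.pi / 8) * Real.log (Real.sqrt (∫ t in T..(T + c), ‖y t‖ ^ 2) /
          Real.sqrt (∫ t in (T - 8 / Real.pi)..(T + c - 8 / Real.pi), ‖y t‖ ^ 2)))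
      Filter.atTop (nhds q) := by
  have hpi := Real.pi_pos
  set L : ℝ := 8 / Real.pi with hLdef
  have hL : 0 < L := by positivity
  let k : ℕ+ → ℤ := fun n => (2 * (n : ℕ) - 1) ^ 2
  let mu : ℕ+ → ℝ := fun n => (((n : ℕ) : ℝ) - 1 / 2) ^ 2 * Real.pi ^ 2
  have hk : Function.Injective k := by
    intro m n h
    simp only [k] at h
    have hm : (1 : ℤ) ≤ ((m : ℕ) : ℤ) := by exact_mod_cast m.pos
    have hn : (1 : ℤ) ≤ ((n : ℕ) : ℤ) := by exact_mod_cast n.pos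
    have := (pow_left_inj₀ (by linarith) (by linarith) two_ne_zero).mp h
    apply PNat.coe_injective
    omega
  have hmu : ∀ n, mu n * L = 2 * Real.pi * k n := by
    intro n
    simp only [mu, k, hLdef]
    push_cast
    field_simp
    ring
  let p : ℝ → ℂ := fun t => ∑' n, a n * Complex.exp (mu n * t * Complex.I)
  have hnt : ∀ (n : ℕ+) (t : ℝ), ‖a n * Complex.exp (mu n * t * Complex.I)‖ = ‖a n‖ := by
    intro n t
    rw [norm_mul, ← Complex.ofReal_mul, Complex.norm_exp_ofReal_mul_I, mul_one]
  have hpc : Continuous p := by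
    refine continuous_tsum (fun n => ?_) ha (fun n t => (hnt n t).le)
    fun_prop
  have hper : Function.Periodic p L := by
    intro t
    refine tsum_congr fun n => ?_
    congr 1
    rw [Complex.exp_eq_exp_iff_exists_int]
    refine ⟨k n, ?_⟩
    have := congrArg (fun x : ℝ => (x : ℂ)) (hmu n)
    push_cast at this ⊢
    linear_combination Complex.I * this
  have hpA : ∀ t, ‖p t‖ ≤ ∑' n, ‖a n‖ := fun t =>
    tsum_of_norm_bounded ha.hasSum (fun n => (hnt n t).le)
  have hK := aux_pos L hL a ha ha0 k hk mu hmu p (fun t => rfl) hpc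
  obtain ⟨hlim, hEpos⟩ := aux_ratio q hq L c M _ hL hc p d hpc hper hpA hdmeas hdM hK
  have hyp : ∀ t, y t = (Real.exp (q * t) : ℂ) * p t + d t := by
    intro t
    rw [hy]
    congr 1
    simp only [p]
    rw [← tsum_mul_left]
    refine tsum_congr fun n => ?_
    rw [mul_left_comm, Complex.ofReal_exp, ← Complex.exp_add, hlam]
    congr 2
    simp only [mu]; push_cast; ring
  simp only [← hyp] at hlim
  set E : ℝ → ℝ := fun T => ∫ t in T..(T + c), ‖(Real.exp (q * t) : ℂ) * p t‖ ^ 2 with hE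
  set J : ℝ → ℝ := fun T => ∫ t in T..(T + c), ‖y t‖ ^ 2 with hJ
  have hshift : ∀ T, E T = Real.exp (q * L) ^ 2 * E (T - L) := by
    intro T
    simp only [hE]
    rw [← intervalIntegral.integral_const_mul]
    have := intervalIntegral.integral_comp_add_right (a := T - L) (b := T - L + c)
      (fun t => ‖(Real.exp (q * t) : ℂ) * p t‖ ^ 2) L
    rw [show T - L + L = T by ring, show T - L + c + L = T + c by ring] at this
    rw [← this]
    congr 1; ext t
    rw [hper t, mul_add, Real.exp_add]
    simp only [norm_mul, mul_pow, Complex.norm_real,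
      Real.norm_of_nonneg (Real.exp_pos _).le]
    ring
  have hlim' : Filter.Tendsto (fun T => J T / E T) Filter.atTop (nhds 1) := hlim
  have hlim2 : Filter.Tendsto (fun T => J (T - L) / E (T - L)) Filter.atTop (nhds 1) :=
    hlim'.comp (Filter.tendsto_atTop_add_const_right _ (-L) Filter.tendsto_id)
  have hrat : Filter.Tendsto (fun T => J T / J (T - L)) Filter.atTop
      (nhds (Real.exp (q * L) ^ 2)) := by
    have := (hlim'.div hlim2 one_ne_zero).const_mul (Real.exp (q * L) ^ 2)
    rw [div_one, mul_one] at this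
    refine this.congr fun T => ?_
    have h1 : E (T - L) ≠ 0 := (hEpos (T - L)).ne'
    have h2 := Real.exp_ne_zero (q * L)
    simp only [Pi.div_apply]
    rw [hshift T]
    by_cases h3 : J (T - L) = 0
    · simp [h3]
    · field_simp
  have hfin := ((hrat.sqrt).log (by positivity)).const_mul (Real.pi / 8)
  rw [Real.sqrt_sq (Real.exp_pos _).le, Real.log_exp,
    show Real.pi / 8 * (q * L) = q by rw [hLdef]; field_simp] at hfin
  refine hfin.congr fun T => ?_
  have hJ0 : 0 ≤ J T := intervalIntegral.integral_nonneg (by linarith) (fun _ _ => by positivity)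
  rw [Real.sqrt_div hJ0, show T + c - L = T - L + c by ring]
end
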